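/- arXiv:1607.03364 — 5 statements merged into one kernel-verified Lean document; each statement's English description precedes it below -/
import Mathlib

section
/- Let N ≥ 2 and let H be an N×N complex Hermitian matrix with trace 0 such that Tr[H²] ≤ 1/(N(N−1)). Then the matrix (1/N)·I + H is positive semidefinite (hence is a density matrix). Consequently, every vector of the (N²−1)-dimensional Bloch-vector space of squared Euclidean norm at most 2/(N(N−1)) is the Bloch vector of a density matrix, and this ball is invariant under all rotations. -/
open Matrix
open scoped ComplexOrder

/-- The trace of the square of a Hermitian matrix is the sum of the squares of its eigenvalues. -/
theorem Matrix.IsHermitian.trace_mul_self_eq_sum_eigenvalues_sq {n : Type*} [Fintype n]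
    [DecidableEq n] {A : Matrix n n ℂ} (hA : A.IsHermitian) :
    (A * A).trace = ((∑ i, hA.eigenvalues i ^ 2 : ℝ) : ℂ) := by
  conv_lhs => rw [hA.spectral_theorem]
  rw [← map_mul, Unitary.conjStarAlgAut_apply, Matrix.trace_mul_cycle, Unitary.coe_star_mul_self,
    one_mul, Matrix.diagonal_mul_diagonal, Matrix.trace_diagonal]
  simp [sq]

/-- A term of a real family with sum `1` is nonnegative as soon as the sum of squares, times the
number of remaining indices, is at most `1`. -/
theorem nonneg_of_sum_eq_one_of_sum_sq_le {n : Type*} [Fintype n] [DecidableEq n] {x : n → ℝ}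
    (hsum : ∑ i, x i = 1)
    (hsq : ((Fintype.card n : ℝ) - 1) * ∑ i, x i ^ 2 ≤ 1) (k : n) : 0 ≤ x k := by
  have hcard : (((Finset.univ.erase k).card : ℕ) : ℝ) = (Fintype.card n : ℝ) - 1 := by
    rw [Finset.card_erase_of_mem (Finset.mem_univ k), Finset.card_univ,
      Nat.cast_pred (Fintype.card_pos_iff.mpr ⟨k⟩)]
  have hcs := sq_sum_le_card_mul_sum_sq (s := Finset.univ.erase k) (f := x)
  rw [hcard] at hcs
  have h₁ := Finset.add_sum_erase Finset.univ x (Finset.mem_univ k)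
  have h₂ := Finset.add_sum_erase Finset.univ (fun i => x i ^ 2) (Finset.mem_univ k)
  have hc : 0 ≤ (Fintype.card n : ℝ) - 1 := hcard ▸ Nat.cast_nonneg _
  rw [hsum] at h₁
  rw [← h₂] at hsq
  rw [show ∑ i ∈ Finset.univ.erase k, x i = 1 - x k by linarith] at hcs
  nlinarith [mul_nonneg hc (sq_nonneg (x k))]

/-- A Hermitian matrix of trace `1` with `(n - 1) * Tr[A²] ≤ 1` is positive semidefinite. -/
theorem Matrix.IsHermitian.posSemidef_of_trace_eq_one {n : Type*} [Fintype n] [DecidableEq n]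
    {A : Matrix n n ℂ} (hA : A.IsHermitian) (htr : A.trace = 1)
    (hsq : ((Fintype.card n : ℝ) - 1) * (A * A).trace.re ≤ 1) : A.PosSemidef := by
  refine hA.posSemidef_iff_eigenvalues_nonneg.mpr fun k => ?_
  refine nonneg_of_sum_eq_one_of_sum_sq_le ?_ ?_ k
  · rw [hA.trace_eq_sum_eigenvalues] at htr
    simpa using congrArg Complex.re htr
  · rwa [hA.trace_mul_self_eq_sum_eigenvalues_sq, Complex.ofReal_re] at hsq

/-- Inscribed-ball criterion for density matrices: if `H` is an `N × N` complex
Hermitian matrix with trace `0` and `Tr[H²] ≤ 1/(N(N−1))`, then `(1/N)·I + H` is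
positive semidefinite (and has trace `1`, hence is a density matrix). Consequently
every Bloch vector of squared Euclidean norm at most `2/(N(N−1))` corresponds to a
density matrix, and this ball is rotation invariant. -/
theorem inscribed_ball_posSemidef
    (N : ℕ) (hN : 2 ≤ N)
    (H : Matrix (Fin N) (Fin N) ℂ) (hH : H.IsHermitian)
    (htr : H.trace = 0)
    (hsq : (H * H).trace.re ≤ 1 / ((N : ℝ) * ((N : ℝ) - 1))) :
    (((N : ℂ)⁻¹ • (1 : Matrix (Fin N) (Fin N) ℂ)) + H).PosSemidef ∧
      (((N : ℂ)⁻¹ • (1 : Matrix (Fin N) (Fin N) ℂ)) + H).trace = 1 := by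
  have hN₀ : (N : ℂ) ≠ 0 := by exact_mod_cast (by omega : N ≠ 0)
  have hN₂ : (2 : ℝ) ≤ N := by exact_mod_cast hN
  have htrace : (((N : ℂ)⁻¹ • (1 : Matrix (Fin N) (Fin N) ℂ)) + H).trace = 1 := by
    simp [Matrix.trace_add, Matrix.trace_smul, htr, hN₀]
  have hherm : (((N : ℂ)⁻¹ • (1 : Matrix (Fin N) (Fin N) ℂ)) + H).IsHermitian := by
    refine Matrix.IsHermitian.add ?_ hH
    simp [Matrix.IsHermitian, Matrix.conjTranspose_smul]
  refine ⟨hherm.posSemidef_of_trace_eq_one htrace ?_, htrace⟩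
  have htrace_sq : ((((N : ℂ)⁻¹ • (1 : Matrix (Fin N) (Fin N) ℂ)) + H) *
      (((N : ℂ)⁻¹ • (1 : Matrix (Fin N) (Fin N) ℂ)) + H)).trace
        = (((N : ℝ)⁻¹ : ℝ) : ℂ) + (H * H).trace := by
    simp [add_mul, mul_add, Matrix.trace_add, Matrix.trace_smul, htr, hN₀]
  rw [htrace_sq, Complex.add_re, Complex.ofReal_re, Fintype.card_fin]
  calc ((N : ℝ) - 1) * ((N : ℝ)⁻¹ + (H * H).trace.re)
      ≤ ((N : ℝ) - 1) * ((N : ℝ)⁻¹ + 1 / ((N : ℝ) * ((N : ℝ) - 1))) := by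
        gcongr
        linarith
    _ = 1 := by
        have : (N : ℝ) - 1 ≠ 0 := by linarith
        field_simp
        ring
end

section
/- Let τ₁ ≥ τ₂ ≥ τ₃ ≥ 0 be real numbers satisfying (1) τ₁² + τ₂² + τ₃² ≤ 3; (2) τ₁² + τ₂² + τ₃² + 2τ₁τ₂τ₃ ≤ 1; and (3) (τ₁ − τ₂ − τ₃ − 1)(τ₁ + τ₂ − τ₃ + 1)(τ₁ − τ₂ + τ₃ + 1)(τ₁ + τ₂ + τ₃ − 1) ≥ 0. Then τ₁ + τ₂ + τ₃ ≤ 1. -/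
/-- The simultaneous positivity conditions for a two-qubit state in normal form and
its partial transpose, in terms of the ordered singular values `τ₁ ≥ τ₂ ≥ τ₃ ≥ 0` of
its correlation matrix, imply `τ₁ + τ₂ + τ₃ ≤ 1` (hence separability). -/
theorem two_qubit_ppt_singular_value_bound
    (τ₁ τ₂ τ₃ : ℝ) (h12 : τ₂ ≤ τ₁) (h23 : τ₃ ≤ τ₂) (h3 : 0 ≤ τ₃)
    (h1 : τ₁ ^ 2 + τ₂ ^ 2 + τ₃ ^ 2 ≤ 3)
    (h2 : τ₁ ^ 2 + τ₂ ^ 2 + τ₃ ^ 2 + 2 * τ₁ * τ₂ * τ₃ ≤ 1)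
    (h4 : (τ₁ - τ₂ - τ₃ - 1) * (τ₁ + τ₂ - τ₃ + 1) * (τ₁ - τ₂ + τ₃ + 1) *
      (τ₁ + τ₂ + τ₃ - 1) ≥ 0) :
    τ₁ + τ₂ + τ₃ ≤ 1 := by
  by_contra! hsum
  have h2nn : 0 ≤ τ₂ := h3.trans h23
  have h1nn : 0 ≤ τ₁ := h2nn.trans h12
  have hprod : 0 ≤ 2 * τ₁ * τ₂ * τ₃ := by positivity
  have hle : τ₁ ≤ 1 := by nlinarith [sq_nonneg τ₂, sq_nonneg τ₃]
  have hA : τ₁ - τ₂ - τ₃ - 1 < 0 := by linarith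
  have hB : 0 < τ₁ + τ₂ - τ₃ + 1 := by linarith
  have hC : 0 < τ₁ - τ₂ + τ₃ + 1 := by linarith
  have hD : 0 < τ₁ + τ₂ + τ₃ - 1 := by linarith
  exact absurd h4 (not_le.mpr
    (mul_neg_of_neg_of_pos (mul_neg_of_neg_of_pos (mul_neg_of_neg_of_pos hA hB) hC) hD))
end

section
/- Let N, M ≥ 1 and let ρ be a separable matrix indexed by (Fin N × Fin M), i.e. ρ = Σ_k p_k (A_k ⊗ B_k) with finitely many p_k ≥ 0 summing to 1 and A_k, B_k complex positive semidefinite matrices of trace 1 of sizes N×N and M×M. Then the partial transpose ρ^{T_B}, defined by (ρ^{T_B})_{(i,j),(k,l)} = ρ_{(i,l),(k,j)}, is positive semidefinite. -/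
open Matrix Kronecker
open scoped ComplexOrder

/-- A bipartite matrix indexed by `Fin N × Fin M` is separable if it is a finite
convex combination of Kronecker products of density matrices (complex positive
semidefinite matrices of trace `1`). -/
def Separable {N M : ℕ} (ρ : Matrix (Fin N × Fin M) (Fin N × Fin M) ℂ) : Prop :=
  ∃ (L : ℕ) (p : Fin L → ℝ)
    (A : Fin L → Matrix (Fin N) (Fin N) ℂ) (B : Fin L → Matrix (Fin M) (Fin M) ℂ),
    (∀ k, 0 ≤ p k) ∧ (∑ k, p k) = 1 ∧
    (∀ k, (A k).PosSemidef ∧ (A k).trace = 1) ∧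
    (∀ k, (B k).PosSemidef ∧ (B k).trace = 1) ∧
    ρ = ∑ k, (p k : ℂ) • (A k ⊗ₖ B k)

/-- The partial transpose on the second subsystem:
`(ρ^{T_B})_{(i,j),(k,l)} = ρ_{(i,l),(k,j)}`. -/
def ptransposeB {N M : ℕ} (ρ : Matrix (Fin N × Fin M) (Fin N × Fin M) ℂ) :
    Matrix (Fin N × Fin M) (Fin N × Fin M) ℂ :=
  Matrix.of fun x y => ρ (x.1, y.2) (y.1, x.2)


theorem ptransposeB_sum_smul_kronecker {ι : Type*} {N M : ℕ} (s : Finset ι) (c : ι → ℂ)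
    (A : ι → Matrix (Fin N) (Fin N) ℂ) (B : ι → Matrix (Fin M) (Fin M) ℂ) :
    ptransposeB (∑ k ∈ s, c k • (A k ⊗ₖ B k)) = ∑ k ∈ s, c k • (A k ⊗ₖ (B k)ᵀ) := by
  ext x y
  simp [ptransposeB, Matrix.sum_apply]

/-- The PPT criterion is necessary for separability: the partial transpose of any
separable state is positive semidefinite. -/
theorem ppt_of_separable
    (N M : ℕ) (hN : 1 ≤ N) (hM : 1 ≤ M)
    (ρ : Matrix (Fin N × Fin M) (Fin N × Fin M) ℂ)
    (hsep : Separable ρ) :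
    (ptransposeB ρ).PosSemidef := by
  obtain ⟨L, p, A, B, hp, -, hA, hB, rfl⟩ := hsep
  rw [ptransposeB_sum_smul_kronecker]
  exact posSemidef_sum _ fun k _ =>
    ((hA k).1.kronecker (hB k).1.transpose).smul (Complex.zero_le_real.mpr (hp k))
end

section
/- Let ρ be a two-qubit density matrix, i.e. a complex positive semidefinite matrix of trace 1 indexed by (Fin 2 × Fin 2). Then ρ is separable if and only if its partial transpose ρ^{T_B}, defined by (ρ^{T_B})_{(i,j),(k,l)} = ρ_{(i,l),(k,j)}, is positive semidefinite. -/
open Matrix Kronecker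
open scoped ComplexOrder

open scoped InnerProductSpace

/-- A triangle with prescribed side lengths closes up in the complex plane. -/
theorem exists_phases_two {a b x : ℝ} (ha : 0 ≤ a) (hx : 0 ≤ x)
    (h1 : |a - b| ≤ x) (h2 : x ≤ a + b) :
    ∃ u v : ℂ, ‖u‖ = 1 ∧ ‖v‖ = 1 ∧ a * u + b * v = x := by
  have hb : b ∈ Set.Icc ‖(x : ℂ) - a * Complex.exp ((0 : ℝ) * Complex.I)‖
      ‖(x : ℂ) - a * Complex.exp ((Real.pi : ℝ) * Complex.I)‖ := by
    rw [Complex.exp_pi_mul_I]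
    have e1 : (x : ℂ) - a * Complex.exp ((0 : ℝ) * Complex.I) = ((x - a : ℝ) : ℂ) := by simp
    have e2 : (x : ℂ) - a * (-1) = ((x + a : ℝ) : ℂ) := by push_cast; ring
    rw [e1, e2, Complex.norm_real, Complex.norm_real, Real.norm_eq_abs, Real.norm_eq_abs]
    rw [abs_le] at h1
    constructor
    · rw [abs_le]; constructor <;> linarith
    · rw [abs_of_nonneg (by positivity)]; linarith
  obtain ⟨t, -, ht⟩ := intermediate_value_Icc (f := fun t : ℝ =>
    ‖(x : ℂ) - a * Complex.exp (t * Complex.I)‖) Real.pi_pos.le (by fun_prop) hb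
  refine ⟨Complex.exp (t * Complex.I),
    Complex.exp (((x : ℂ) - a * Complex.exp (t * Complex.I)).arg * Complex.I),
    Complex.norm_exp_ofReal_mul_I _, Complex.norm_exp_ofReal_mul_I _, ?_⟩
  have := Complex.norm_mul_exp_arg_mul_I ((x : ℂ) - a * Complex.exp (t * Complex.I))
  simp only at ht
  rw [ht] at this
  rw [this]; ring

theorem exists_phases_four {a b c d : ℝ} (ha : 0 ≤ a) (hb : 0 ≤ b) (hc : 0 ≤ c) (hd : 0 ≤ d)
    (h1 : a ≤ b + c + d) (h2 : b ≤ a + c + d) (h3 : c ≤ a + b + d) (h4 : d ≤ a + b + c) :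
    ∃ p q r s : ℂ, ‖p‖ = 1 ∧ ‖q‖ = 1 ∧ ‖r‖ = 1 ∧ ‖s‖ = 1 ∧
      a * p ^ 2 + b * q ^ 2 + c * r ^ 2 + d * s ^ 2 = 0 := by
  have sqrt_unit : ∀ z : ℂ, ‖z‖ = 1 → ∃ y : ℂ, ‖y‖ = 1 ∧ y ^ 2 = z := fun z hz => by
    obtain ⟨y, hy⟩ := IsAlgClosed.exists_pow_nat_eq z (n := 2) (by norm_num)
    refine ⟨y, ?_, hy⟩
    rw [← hy, norm_pow] at hz
    exact (pow_eq_one_iff_of_nonneg (norm_nonneg y) two_ne_zero).1 hz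
  set x := max |a - b| |c - d| with hx
  have hx0 : 0 ≤ x := le_max_of_le_left (abs_nonneg _)
  obtain ⟨u, v, hu, hv, huv⟩ := exists_phases_two (b := b) ha hx0 (le_max_left _ _) (max_le
    (abs_le.2 ⟨by linarith, by linarith⟩) (abs_le.2 ⟨by linarith, by linarith⟩))
  obtain ⟨w, z, hw, hz, hwz⟩ := exists_phases_two (b := d) hc hx0 (le_max_right _ _) (max_le
    (abs_le.2 ⟨by linarith, by linarith⟩) (abs_le.2 ⟨by linarith, by linarith⟩))
  obtain ⟨p, hp, rfl⟩ := sqrt_unit u hu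
  obtain ⟨q, hq, rfl⟩ := sqrt_unit v hv
  obtain ⟨r, hr, hr'⟩ := sqrt_unit (-w) (by simpa)
  obtain ⟨s, hs, hs'⟩ := sqrt_unit (-z) (by simpa)
  refine ⟨p, q, r, s, hp, hq, hr, hs, ?_⟩
  rw [hr', hs']
  linear_combination huv - hwz

section Takagi
variable {E : Type*} [NormedAddCommGroup E] [InnerProductSpace ℂ E]

theorem exists_unit_coneigenvector [FiniteDimensional ℂ E] [Nontrivial E]
    (A : E →ₗ⋆[ℂ] E) (hA : ∀ x y, ⟪x, A y⟫_ℂ = ⟪y, A x⟫_ℂ) :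
    ∃ (u : E) (μ : ℝ), ‖u‖ = 1 ∧ 0 ≤ μ ∧ A u = (μ : ℂ) • u := by
  suffices h : ∃ (u : E) (μ : ℝ), u ≠ 0 ∧ 0 ≤ μ ∧ A u = (μ : ℂ) • u by
    obtain ⟨u, μ, hu, hμ, h⟩ := h
    refine ⟨((‖u‖⁻¹ : ℝ) : ℂ) • u, μ, ?_, hμ, ?_⟩
    · rw [norm_smul, Complex.norm_real, norm_inv, norm_norm,
        inv_mul_cancel₀ (norm_ne_zero_iff.2 hu)]
    · rw [map_smulₛₗ, h, Complex.conj_ofReal, smul_comm]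
  obtain ⟨κ, hκ⟩ := Module.End.exists_eigenvalue (K := ℂ) (A.comp A : E →ₗ[ℂ] E)
  obtain ⟨v, hv⟩ := hκ.exists_hasEigenvector
  have hv0 : v ≠ 0 := hv.2
  have hAA : A (A v) = κ • v := hv.apply_eq_smul
  set μ : ℝ := ‖A v‖ / ‖v‖ with hμ
  have hn : (‖v‖ : ℂ) ≠ 0 := by simpa using hv0
  have hκμ : κ = (μ : ℂ) ^ 2 := by
    have := hA v (A v)
    rw [hAA, inner_smul_right, inner_self_eq_norm_sq_to_K, inner_self_eq_norm_sq_to_K] at this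
    rw [hμ]; push_cast
    field_simp
    exact this
  have hμ0 : 0 ≤ μ := by positivity
  by_cases h : A v + (μ : ℂ) • v = 0
  · refine ⟨Complex.I • v, μ, smul_ne_zero Complex.I_ne_zero hv0, hμ0, ?_⟩
    rw [map_smulₛₗ, eq_neg_of_add_eq_zero_left h, Complex.conj_I, neg_smul_neg, smul_comm]
  · refine ⟨_, μ, h, hμ0, ?_⟩
    rw [map_add, map_smulₛₗ, hAA, hκμ, Complex.conj_ofReal, smul_add, smul_smul, sq, add_comm]

theorem exists_orthonormalBasis_coneigenvectors (n : ℕ) : ∀ {E : Type*} [NormedAddCommGroup E]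
    [InnerProductSpace ℂ E] [FiniteDimensional ℂ E] (_ : Module.finrank ℂ E = n)
    (A : E →ₗ⋆[ℂ] E) (_ : ∀ x y, ⟪x, A y⟫_ℂ = ⟪y, A x⟫_ℂ),
    ∃ (b : Fin n → E) (μ : Fin n → ℝ), Orthonormal ℂ b ∧ (∀ i, 0 ≤ μ i) ∧
      ∀ i, A (b i) = (μ i : ℂ) • b i := by
  induction n with
  | zero =>
    intro E _ _ _ _ A _
    exact ⟨Fin.elim0, Fin.elim0, ⟨fun i => i.elim0, fun i => i.elim0⟩, fun i => i.elim0,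
      fun i => i.elim0⟩
  | succ n ih =>
    intro E _ _ _ hn A hA
    have : Nontrivial E := Module.nontrivial_of_finrank_pos (R := ℂ) (by omega)
    obtain ⟨u, μ, hu, hμ, hAu⟩ := exists_unit_coneigenvector A hA
    have : Fact (Module.finrank ℂ E = n + 1) := ⟨hn⟩
    let F := (ℂ ∙ u)ᗮ
    have hF : Module.finrank ℂ F = n :=
      Submodule.finrank_orthogonal_span_singleton (by rintro rfl; simp at hu)
    have hAF : ∀ x ∈ F, A x ∈ F := fun x hx => by
      rw [Submodule.mem_orthogonal_singleton_iff_inner_right] at hx ⊢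
      rw [hA, hAu, inner_smul_right, inner_eq_zero_symm.1 hx, mul_zero]
    obtain ⟨b, ν, hb, hν, hAb⟩ := ih hF (A.restrict hAF) (fun x y => hA x y)
    refine ⟨Fin.cons u (fun i => (b i : E)), Fin.cons μ ν, ?_, ?_, ?_⟩
    · have hb' : Orthonormal ℂ (fun i => (b i : E)) := hb.comp_linearIsometry F.subtypeₗᵢ
      have hub : ∀ i, ⟪u, (b i : E)⟫_ℂ = 0 := fun i =>
        Submodule.mem_orthogonal_singleton_iff_inner_right.1 (b i).2
      refine ⟨fun i => ?_, fun i j hij => ?_⟩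
      · refine Fin.cases hu (fun i => hb'.1 i) i
      · induction i using Fin.cases with
        | zero => induction j using Fin.cases with
          | zero => exact absurd rfl hij
          | succ j => exact hub j
        | succ i => induction j using Fin.cases with
          | zero => exact inner_eq_zero_symm.1 (hub i)
          | succ j => exact hb'.2 (fun h => hij (congrArg _ h))
    · exact Fin.cases hμ hν
    · refine Fin.cases hAu fun i => ?_
      simpa using congrArg Subtype.val (hAb i)
end Takagi

section
variable {n : Type*} [Fintype n] [DecidableEq n]

theorem exists_unitary_transpose_mul_mul_eq_diagonal (τ : Matrix n n ℂ) (hτ : τᵀ = τ) :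
    ∃ U ∈ unitaryGroup n ℂ, ∃ μ : n → ℝ, (∀ i, 0 ≤ μ i) ∧
      Uᵀ * τ * U = diagonal fun i => (μ i : ℂ) := by
  let A : EuclideanSpace ℂ n →ₗ⋆[ℂ] EuclideanSpace ℂ n :=
    { toFun := fun x => WithLp.toLp 2 (star (τ *ᵥ x.ofLp))
      map_add' := fun x y => by simp [mulVec_add]
      map_smul' := fun c x => by ext i; simp [mulVec_smul] }
  have hA : ∀ x y, ⟪x, A y⟫_ℂ = ⟪y, A x⟫_ℂ := fun x y => by
    simp only [EuclideanSpace.inner_eq_star_dotProduct, A, LinearMap.coe_mk, AddHom.coe_mk]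
    rw [star_dotProduct_star, star_dotProduct_star, dotProduct_mulVec, ← mulVec_transpose, hτ,
      dotProduct_comm]
  obtain ⟨b, μ, hb, hμ, hAb⟩ := exists_orthonormalBasis_coneigenvectors _
    (finrank_euclideanSpace (𝕜 := ℂ) (ι := n)) A hA
  let e := Fintype.equivFin n
  let U : Matrix n n ℂ := of fun i k => b (e k) i
  have hU : Uᴴ * U = 1 := by
    ext k l
    have := orthonormal_iff_ite.1 hb (e k) (e l)
    simp only [EuclideanSpace.inner_eq_star_dotProduct, e.injective.eq_iff] at this
    rw [one_apply, ← this, dotProduct_comm]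
    rfl
  refine ⟨U, mem_unitaryGroup_iff'.2 hU, fun i => μ (e i), fun i => hμ _, ?_⟩
  have hτU : τ * U = U.map star * diagonal fun i => (μ (e i) : ℂ) := by
    ext i k
    have := congrArg (fun x : EuclideanSpace ℂ n => star (x i)) (hAb (e k))
    simp only [A, LinearMap.coe_mk, AddHom.coe_mk, Pi.star_apply, PiLp.smul_apply,
      smul_eq_mul, star_mul', RCLike.star_def, Complex.conj_ofReal, Complex.conj_conj] at this
    rw [mul_diagonal, map_apply, mul_comm]
    exact this
  rw [Matrix.mul_assoc, hτU, ← Matrix.mul_assoc]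
  have : Uᵀ * U.map star = 1 := by
    rw [← transpose_one, ← hU, transpose_mul, conjTranspose, transpose_map, transpose_transpose]
  rw [this, Matrix.one_mul]

open scoped MatrixOrder Matrix.Norms.L2Operator in
theorem exists_mul_conjTranspose_and_congruent_diagonal {ρ S : Matrix n n ℂ}
    (hρ : ρ.PosDef) (hS : Sᵀ = S) (hS' : S.det ≠ 0) :
    ∃ (W : Matrix n n ℂ) (μ : n → ℝ), W * Wᴴ = ρ ∧ (∀ i, 0 < μ i) ∧
      Wᵀ * S * W = diagonal fun i => (μ i : ℂ) := by
  obtain ⟨B, rfl⟩ : ∃ B : Matrix n n ℂ, ρ = star B * B :=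
    CStarAlgebra.nonneg_iff_eq_star_mul_self.1 hρ.posSemidef.nonneg
  obtain ⟨U, hU, μ, hμ, h⟩ := exists_unitary_transpose_mul_mul_eq_diagonal (Bᴴᵀ * S * Bᴴ)
    (by rw [transpose_mul, transpose_mul, hS, transpose_transpose, Matrix.mul_assoc])
  have hdet : (diagonal fun i => (μ i : ℂ)).det ≠ 0 := by
    have h1 := hρ.det_pos.ne'
    have h2 : U.det ≠ 0 := fun h0 => by
      have := congrArg det (mem_unitaryGroup_iff.1 hU)
      simp [h0] at this
    rw [star_eq_conjTranspose, det_mul, mul_ne_zero_iff] at h1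
    rw [← h]
    simp only [det_mul, det_transpose]
    exact mul_ne_zero (mul_ne_zero h2 (mul_ne_zero (mul_ne_zero h1.1 hS') h1.1)) h2
  refine ⟨Bᴴ * U, μ, ?_, fun i => (hμ i).lt_of_ne' fun h0 => hdet ?_, ?_⟩
  · rw [conjTranspose_mul, Matrix.mul_assoc, ← Matrix.mul_assoc U, ← star_eq_conjTranspose U,
      mem_unitaryGroup_iff.1 hU, Matrix.one_mul, conjTranspose_conjTranspose,
      star_eq_conjTranspose]
  · rw [det_diagonal]
    exact Finset.prod_eq_zero (Finset.mem_univ i) (by simp [h0])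
  · rw [← h, transpose_mul]
    simp only [Matrix.mul_assoc]

omit [DecidableEq n] in
theorem posDef_smul_add_conjTranspose_mul_mul {H L : Matrix n n ℂ} {c : ℝ} (hH : H.PosDef)
    (hc : 0 < c) : ((c : ℂ) • H + Lᴴ * H * L).PosDef :=
  (hH.smul (by exact_mod_cast hc)).add_posSemidef (hH.posSemidef.conjTranspose_mul_mul_same L)

theorem conj_smul_add_self {H L : Matrix n n ℂ} {c : ℝ}
    (hL : L * L = -((c : ℂ) • 1)) :
    Lᴴ * ((c : ℂ) • H + Lᴴ * H * L) * L = (c : ℂ) • ((c : ℂ) • H + Lᴴ * H * L) := by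
  have hL' : Lᴴ * Lᴴ = -((c : ℂ) • 1) := by
    rw [← conjTranspose_mul, hL]; simp
  have : Lᴴ * (Lᴴ * H * L) * L = (Lᴴ * Lᴴ) * H * (L * L) := by simp only [Matrix.mul_assoc]
  rw [Matrix.mul_add, Matrix.add_mul, this, hL, hL']
  simp [add_comm]

omit [DecidableEq n] in
theorem conj_smul_add_of_anticommute {H K L : Matrix n n ℂ} {k : ℂ} (c : ℂ)
    (hH : Kᴴ * H * K = k • H) (hKL : K * L = -(L * K)) :
    Kᴴ * (c • H + Lᴴ * H * L) * K = k • (c • H + Lᴴ * H * L) := by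
  have hKL' : Kᴴ * Lᴴ = -(Lᴴ * Kᴴ) := by
    rw [← conjTranspose_mul, ← conjTranspose_mul, ← conjTranspose_neg, hKL, neg_neg]
  have hLK : L * K = -(K * L) := by rw [hKL, neg_neg]
  have : Kᴴ * (Lᴴ * H * L) * K = (Kᴴ * Lᴴ) * H * (L * K) := by simp only [Matrix.mul_assoc]
  have h2 : Lᴴ * Kᴴ * H * (K * L) = Lᴴ * (Kᴴ * H * K) * L := by simp only [Matrix.mul_assoc]
  rw [Matrix.mul_add, Matrix.add_mul, this, hLK, hKL', Matrix.neg_mul, Matrix.neg_mul,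
    Matrix.mul_neg, neg_neg, h2, hH, Matrix.mul_smul, Matrix.smul_mul, hH]
  simp only [Matrix.mul_smul, Matrix.smul_mul, smul_add]
  rw [smul_comm]

theorem exists_posDef_conj_eq_smul {L₁ L₂ L₃ : Matrix n n ℂ} {c₁ c₂ c₃ : ℝ}
    (hc₁ : 0 < c₁) (hc₂ : 0 < c₂) (hc₃ : 0 < c₃)
    (h₁ : L₁ * L₁ = -((c₁ : ℂ) • 1)) (h₂ : L₂ * L₂ = -((c₂ : ℂ) • 1))
    (h₃ : L₃ * L₃ = -((c₃ : ℂ) • 1)) (h₁₂ : L₁ * L₂ = -(L₂ * L₁)) (h₁₃ : L₁ * L₃ = -(L₃ * L₁))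
    (h₂₃ : L₂ * L₃ = -(L₃ * L₂)) :
    ∃ H : Matrix n n ℂ, H.PosDef ∧ L₁ᴴ * H * L₁ = (c₁ : ℂ) • H ∧ L₂ᴴ * H * L₂ = (c₂ : ℂ) • H ∧
      L₃ᴴ * H * L₃ = (c₃ : ℂ) • H :=
  ⟨_, posDef_smul_add_conjTranspose_mul_mul (posDef_smul_add_conjTranspose_mul_mul
      (posDef_smul_add_conjTranspose_mul_mul PosDef.one hc₁) hc₂) hc₃,
    conj_smul_add_of_anticommute _ (conj_smul_add_of_anticommute _ (conj_smul_add_self h₁) h₁₂) h₁₃,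
    conj_smul_add_of_anticommute _ (conj_smul_add_self h₂) h₂₃, conj_smul_add_self h₃⟩

end

theorem mul_self_of_trace_eq_zero {R : Type*} [CommRing R] {L : Matrix (Fin 2) (Fin 2) R}
    (hL : L.trace = 0) : L * L = -(L.det • 1) := by
  rw [trace_fin_two] at hL
  ext i j
  fin_cases i <;> fin_cases j <;> simp [mul_apply, det_fin_two, Fin.sum_univ_two]
  · linear_combination L 0 0 * hL
  · linear_combination L 0 1 * hL
  · linear_combination L 1 0 * hL
  · linear_combination L 1 1 * hL

theorem mul_eq_neg_mul_of_trace_eq_zero {R : Type*} [CommRing R]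
    {K L : Matrix (Fin 2) (Fin 2) R} (hK : K.trace = 0) (hL : L.trace = 0)
    (hKL : (K * L).trace = 0) : K * L = -(L * K) := by
  simp only [trace_fin_two, mul_apply, Fin.sum_univ_two] at hK hL hKL
  ext i j
  fin_cases i <;> fin_cases j <;> simp [mul_apply, Fin.sum_univ_two]
  · linear_combination hKL + K 0 0 * hL - L 1 1 * hK
  · linear_combination K 0 1 * hL + L 0 1 * hK
  · linear_combination K 1 0 * hL + L 1 0 * hK
  · linear_combination hKL + K 1 1 * hL - L 0 0 * hK

local notation "ε" => (!![0, 1; -1, 0] : Matrix (Fin 2) (Fin 2) ℂ)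

theorem trace_spinFlip_mul (H L : Matrix (Fin 2) (Fin 2) ℂ) (hL : L.trace = 0) :
    (ε * Hᵀ * L.map star * ε * H * L).trace = (H.adjugate * (Lᴴ * H * L)).trace := by
  have h1 : L 1 1 = - L 0 0 := by rw [trace_fin_two] at hL; linear_combination hL
  simp only [trace_fin_two, adjugate_fin_two, mul_apply, Fin.sum_univ_two, of_apply, cons_val', cons_val_zero, cons_val_one,
    cons_val_fin_one, transpose_apply,
    conjTranspose_apply, map_apply, h1, star_neg]
  ring

theorem trace_spinFlip_mul_one (H : Matrix (Fin 2) (Fin 2) ℂ) :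
    (ε * Hᵀ * ε * H).trace = -(2 * H.det) := by
  simp only [trace_fin_two, det_fin_two, mul_apply, Fin.sum_univ_two, of_apply, cons_val', cons_val_zero, cons_val_one,
    cons_val_fin_one, transpose_apply]
  ring

/-- The value at `T` of the partial transpose of the rank-one form of `M`. -/
noncomputable def ptForm (M T : Matrix (Fin 2) (Fin 2) ℂ) : ℂ :=
  (T.map star * M * T * M.map star).trace

theorem ptForm_mul_conj_adjugate (M N H : Matrix (Fin 2) (Fin 2) ℂ) (hH : H.IsHermitian) :
    ptForm M (ε * H * N.adjugate.map star) =
      (ε * Hᵀ * (N.adjugate * M) * ε * H * (N.adjugate * M).map star).trace := by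
  have hε : (ε).map star = ε := by ext i j; fin_cases i <;> fin_cases j <;> simp
  have hHt : H.map star = Hᵀ := by
    ext i j; exact hH.apply j i
  have hmul : ∀ A B : Matrix (Fin 2) (Fin 2) ℂ, (A * B).map star = A.map star * B.map star :=
    fun A B => Matrix.map_mul (f := starRingEnd ℂ)
  have hinv : ∀ A : Matrix (Fin 2) (Fin 2) ℂ, (A.map star).map star = A :=
    fun A => by ext; simp
  simp only [ptForm, hmul, hε, hHt, hinv, Matrix.mul_assoc]

theorem le_add_of_ptForm_nonneg {M₀ M₁ M₂ M₃ : Matrix (Fin 2) (Fin 2) ℂ} {d₀ d₁ d₂ d₃ : ℝ}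
    (hd₀ : 0 < d₀) (hd₁ : 0 < d₁) (hd₂ : 0 < d₂) (hd₃ : 0 < d₃)
    (h₀ : M₀.det = d₀) (h₁ : M₁.det = d₁) (h₂ : M₂.det = d₂) (h₃ : M₃.det = d₃)
    (h₀₁ : (M₀.adjugate * M₁).trace = 0) (h₀₂ : (M₀.adjugate * M₂).trace = 0)
    (h₀₃ : (M₀.adjugate * M₃).trace = 0) (h₁₂ : (M₁.adjugate * M₂).trace = 0)
    (h₁₃ : (M₁.adjugate * M₃).trace = 0) (h₂₃ : (M₂.adjugate * M₃).trace = 0)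
    (h : ∀ T, 0 ≤ ptForm M₀ T + ptForm M₁ T + ptForm M₂ T + ptForm M₃ T) :
    d₀ ≤ d₁ + d₂ + d₃ := by
  have hstar : ∀ A : Matrix (Fin 2) (Fin 2) ℂ, (A.map star).trace = star A.trace :=
    fun A => by simp [trace]
  have htr : ∀ M, (M₀.adjugate * M).trace = 0 → ((M₀.adjugate * M).map star).trace = 0 :=
    fun M hM => by rw [hstar, hM, star_zero]
  have hsq : ∀ (M) (d : ℝ), (M₀.adjugate * M).trace = 0 → M.det = (d : ℂ) →
      (M₀.adjugate * M).map star * (M₀.adjugate * M).map star =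
        -(((d₀ * d : ℝ) : ℂ) • (1 : Matrix (Fin 2) (Fin 2) ℂ)) := fun M d hM hd => by
    rw [mul_self_of_trace_eq_zero (htr M hM)]
    have : ((M₀.adjugate * M).map star).det = star (M₀.adjugate * M).det :=
      ((starRingEnd ℂ).map_det _).symm
    rw [this, det_mul, hd, det_adjugate, h₀]
    simp
  have hac : ∀ M N, (M₀.adjugate * M).trace = 0 → (M₀.adjugate * N).trace = 0 →
      (M.adjugate * N).trace = 0 → (M₀.adjugate * M).map star * (M₀.adjugate * N).map star =
        -((M₀.adjugate * N).map star * (M₀.adjugate * M).map star) := fun M N hM hN hMN => by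
    refine mul_eq_neg_mul_of_trace_eq_zero (htr M hM) (htr N hN) ?_
    have : (M₀.adjugate * M).map star * (M₀.adjugate * N).map star =
      (M₀.adjugate * M * (M₀.adjugate * N)).map star := (Matrix.map_mul (f := starRingEnd ℂ)).symm
    have h' : (M₀.adjugate * M * (M₀.adjugate * N)).trace = 0 := by
      simp only [trace_fin_two, adjugate_fin_two, mul_apply, Fin.sum_univ_two, of_apply, cons_val',
        cons_val_zero, cons_val_one, cons_val_fin_one] at hM hN hMN ⊢
      linear_combination (M₀ 1 1 * N 0 0 + -M₀ 0 1 * N 1 0 + (-M₀ 1 0 * N 0 1 + M₀ 0 0 * N 1 1)) * hM - (M₀ 0 0 * M₀ 1 1 - M₀ 0 1 * M₀ 1 0) * hMN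
    rw [this, hstar, h', star_zero]
  obtain ⟨H, hH, e₁, e₂, e₃⟩ := exists_posDef_conj_eq_smul (mul_pos hd₀ hd₁) (mul_pos hd₀ hd₂)
    (mul_pos hd₀ hd₃) (hsq M₁ d₁ h₀₁ h₁) (hsq M₂ d₂ h₀₂ h₂) (hsq M₃ d₃ h₀₃ h₃)
    (hac _ _ h₀₁ h₀₂ h₁₂) (hac _ _ h₀₁ h₀₃ h₁₃) (hac _ _ h₀₂ h₀₃ h₂₃)
  have hval : ∀ (M) (d : ℝ), (M₀.adjugate * M).trace = 0 →
      ((M₀.adjugate * M).map star)ᴴ * H * (M₀.adjugate * M).map star = ((d₀ * d : ℝ) : ℂ) • H →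
      ptForm M (ε * H * M₀.adjugate.map star) = 2 * (d₀ * d) * H.det := fun M d hM he => by
    rw [ptForm_mul_conj_adjugate _ _ _ hH.isHermitian]
    have hinv : M₀.adjugate * M = ((M₀.adjugate * M).map star).map star := by
      ext; simp only [map_apply, star_star]
    nth_rewrite 1 [hinv]
    rw [trace_spinFlip_mul _ _ (htr M hM), he, Matrix.mul_smul, adjugate_mul]
    simp [trace_smul]
    ring
  have hval₀ : ptForm M₀ (ε * H * M₀.adjugate.map star) = -(2 * (d₀ * d₀) * H.det) := by
    have h1 : ((d₀ : ℂ) • (1 : Matrix (Fin 2) (Fin 2) ℂ)).map star = (d₀ : ℂ) • 1 := by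
      ext i j
      by_cases hij : i = j <;> simp [one_apply, hij]
    rw [ptForm_mul_conj_adjugate _ _ _ hH.isHermitian, adjugate_mul, h₀, h1]
    simp only [Matrix.mul_smul, Matrix.smul_mul, Matrix.mul_one, trace_smul,
      trace_spinFlip_mul_one, smul_eq_mul]
    ring
  have key := h (ε * H * M₀.adjugate.map star)
  rw [hval₀, hval _ _ h₀₁ e₁, hval _ _ h₀₂ e₂, hval _ _ h₀₃ e₃] at key
  obtain ⟨D, hD⟩ : ∃ D : ℝ, (D : ℂ) = H.det := by
    exact ⟨H.det.re, Complex.ext rfl (Complex.pos_iff.1 hH.det_pos).2⟩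
  have hDpos : 0 < D := by have := hH.det_pos; rw [← hD] at this; exact_mod_cast this
  rw [← hD] at key
  have key' : 0 ≤ 2 * d₀ * D * (d₁ + d₂ + d₃ - d₀) := by
    have : (0 : ℂ) ≤ ((2 * d₀ * D * (d₁ + d₂ + d₃ - d₀) : ℝ) : ℂ) := by
      convert key using 1; push_cast; ring
    exact_mod_cast this
  have := nonneg_of_mul_nonneg_right key' (by positivity)
  linarith

/-- The `2 × 2` matrix whose entries are the `k`-th column of `W`. -/
def columnMatrix {m n κ R : Type*} (W : Matrix (m × n) κ R) (k : κ) : Matrix m n R :=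
  of fun i j => W (i, j) k

theorem transpose_mul_kronecker_mul_apply (W : Matrix (Fin 2 × Fin 2) (Fin 2 × Fin 2) ℂ)
    (k l : Fin 2 × Fin 2) :
    (Wᵀ * (ε ⊗ₖ ε) * W) k l = ((columnMatrix W k).adjugate * columnMatrix W l).trace := by
  simp only [columnMatrix, trace_fin_two, adjugate_fin_two, mul_apply, Fin.sum_univ_two,
    Fintype.sum_prod_type, kronecker_apply, transpose_apply, of_apply, cons_val', cons_val_zero,
    cons_val_one, cons_val_fin_one]
  ring

theorem star_dotProduct_ptransposeB_mulVec (W : Matrix (Fin 2 × Fin 2) (Fin 2 × Fin 2) ℂ)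
    (T : Matrix (Fin 2) (Fin 2) ℂ) :
    star (fun x : Fin 2 × Fin 2 => T x.2 x.1) ⬝ᵥ
      ptransposeB (W * Wᴴ) *ᵥ (fun x : Fin 2 × Fin 2 => T x.2 x.1) =
      ∑ k, ptForm (columnMatrix W k) T := by
  simp only [ptForm, columnMatrix, ptransposeB, dotProduct, mulVec, trace_fin_two, mul_apply,
    Fin.sum_univ_two, Fintype.sum_prod_type, map_apply, conjTranspose_apply, of_apply,
    Pi.star_apply]
  ring

theorem exists_unitary_diag_eq_zero {μ : Fin 2 × Fin 2 → ℝ} (hμ : ∀ i, 0 ≤ μ i)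
    (h₁ : μ (0, 0) ≤ μ (0, 1) + μ (1, 0) + μ (1, 1))
    (h₂ : μ (0, 1) ≤ μ (0, 0) + μ (1, 0) + μ (1, 1))
    (h₃ : μ (1, 0) ≤ μ (0, 0) + μ (0, 1) + μ (1, 1))
    (h₄ : μ (1, 1) ≤ μ (0, 0) + μ (0, 1) + μ (1, 0)) :
    ∃ Q : Matrix (Fin 2 × Fin 2) (Fin 2 × Fin 2) ℂ, Q * Qᴴ = 1 ∧
      ∀ k, (Qᵀ * (diagonal fun i => (μ i : ℂ)) * Q) k k = 0 := by
  obtain ⟨p, q, r, s, hp, hq, hr, hs, h⟩ :=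
    exists_phases_four (hμ _) (hμ _) (hμ _) (hμ _) h₁ h₂ h₃ h₄
  let η : Matrix (Fin 2) (Fin 2) ℂ := !![1, 1; 1, -1]
  let z : Matrix (Fin 2) (Fin 2) ℂ := !![p, q; r, s]
  have hz : ∀ i j, z i j * star (z i j) = 1 := fun i j => by
    have : ‖z i j‖ = 1 := by fin_cases i <;> fin_cases j <;> assumption
    rw [RCLike.star_def, Complex.mul_conj', this]; simp
  have hη : (η ⊗ₖ η) * (η ⊗ₖ η)ᴴ = (4 : ℂ) • 1 := by
    rw [conjTranspose_kronecker, ← mul_kronecker_mul]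
    have : η * ηᴴ = (2 : ℂ) • 1 := by
      ext i j
      fin_cases i <;> fin_cases j <;> simp [η, mul_apply, Fin.sum_univ_two] <;> norm_num
    rw [this, smul_kronecker, kronecker_smul, one_kronecker_one, smul_smul]
    norm_num
  let D : Matrix (Fin 2 × Fin 2) (Fin 2 × Fin 2) ℂ := diagonal fun x => z x.1 x.2
  have hD : D * Dᴴ = 1 := by
    rw [diagonal_conjTranspose, diagonal_mul_diagonal, ← diagonal_one]
    exact congrArg _ (funext fun x => hz _ _)
  refine ⟨(2⁻¹ : ℂ) • (D * (η ⊗ₖ η)), ?_, fun k => ?_⟩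
  · rw [conjTranspose_smul, conjTranspose_mul, Matrix.smul_mul, Matrix.mul_smul, Matrix.mul_assoc,
      ← Matrix.mul_assoc (η ⊗ₖ η), hη, Matrix.smul_mul, Matrix.one_mul, Matrix.mul_smul, hD,
      smul_smul, smul_smul]
    norm_num
  · have hηsq : ∀ i j, η i j ^ 2 = 1 := fun i j => by
      fin_cases i <;> fin_cases j <;> simp [η]
    have hQ : ∀ x, ((2⁻¹ : ℂ) • (D * (η ⊗ₖ η))) x k =
        2⁻¹ * (z x.1 x.2 * (η x.1 k.1 * η x.2 k.2)) := fun x => by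
      rw [Matrix.smul_apply, diagonal_mul, kronecker_apply, smul_eq_mul]
    have hsq : ∀ (i j) (m w : ℂ), 2⁻¹ * (w * (η i k.1 * η j k.2)) * m *
        (2⁻¹ * (w * (η i k.1 * η j k.2))) = 4⁻¹ * (m * w ^ 2) := fun i j m w => by
      linear_combination 4⁻¹ * m * w ^ 2 * (η j k.2 ^ 2 * hηsq i k.1 + hηsq j k.2)
    rw [mul_apply]
    simp only [mul_diagonal, transpose_apply, hQ, hsq, Fintype.sum_prod_type, Fin.sum_univ_two,
      z, of_apply, cons_val', cons_val_zero, cons_val_one, cons_val_fin_one]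
    linear_combination 4⁻¹ * h

/-- A decomposition of `ρ` into four rank-one terms given by product vectors. -/
def HasProductColumns (ρ : Matrix (Fin 2 × Fin 2) (Fin 2 × Fin 2) ℂ) : Prop :=
  ∃ W : Matrix (Fin 2 × Fin 2) (Fin 2 × Fin 2) ℂ, W * Wᴴ = ρ ∧ ∀ k, (columnMatrix W k).det = 0

theorem hasProductColumns_of_posDef {ρ : Matrix (Fin 2 × Fin 2) (Fin 2 × Fin 2) ℂ}
    (hρ : ρ.PosDef) (hpt : (ptransposeB ρ).PosSemidef) : HasProductColumns ρ := by
  obtain ⟨W, μ, rfl, hμ, hW⟩ := exists_mul_conjTranspose_and_congruent_diagonal hρ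
    (S := ε ⊗ₖ ε) (by ext ⟨i, j⟩ ⟨k, l⟩; fin_cases i <;> fin_cases j <;> fin_cases k <;>
      fin_cases l <;> simp) (by rw [det_kronecker]; simp [det_fin_two])
  have hdet : ∀ V : Matrix (Fin 2 × Fin 2) (Fin 2 × Fin 2) ℂ, ∀ k,
      (Vᵀ * (ε ⊗ₖ ε) * V) k k = 2 * (columnMatrix V k).det := fun V k => by
    rw [transpose_mul_kronecker_mul_apply, adjugate_mul, trace_smul, trace_one]
    simp [mul_comm]
  have hd : ∀ k, (columnMatrix W k).det = ((μ k / 2 : ℝ) : ℂ) := fun k => by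
    have := hdet W k
    rw [hW, diagonal_apply_eq] at this
    push_cast
    linear_combination -this / 2
  have ho : ∀ k l, k ≠ l → ((columnMatrix W k).adjugate * columnMatrix W l).trace = 0 :=
    fun k l hkl => by rw [← transpose_mul_kronecker_mul_apply, hW, diagonal_apply_ne _ hkl]
  have hform : ∀ T, 0 ≤ ∑ k, ptForm (columnMatrix W k) T := fun T => by
    rw [← star_dotProduct_ptransposeB_mulVec]
    exact hpt.dotProduct_mulVec_nonneg _
  have key : ∀ i j k l, i ≠ j → i ≠ k → i ≠ l → j ≠ k → j ≠ l → k ≠ l →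
      (∀ f : Fin 2 × Fin 2 → ℂ, ∑ x, f x = f i + f j + f k + f l) →
      μ i ≤ μ j + μ k + μ l := fun i j k l hij hik hil hjk hjl hkl hsum => by
    have := le_add_of_ptForm_nonneg (half_pos (hμ i)) (half_pos (hμ j)) (half_pos (hμ k))
      (half_pos (hμ l)) (hd i) (hd j) (hd k) (hd l) (ho _ _ hij) (ho _ _ hik) (ho _ _ hil)
      (ho _ _ hjk) (ho _ _ hjl) (ho _ _ hkl) (fun T => (hsum fun x => ptForm (columnMatrix W x) T) ▸ hform T)
    linarith
  obtain ⟨Q, hQ, hQ'⟩ := exists_unitary_diag_eq_zero (fun i => (hμ i).le)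
    (key (0, 0) (0, 1) (1, 0) (1, 1) (by decide) (by decide) (by decide) (by decide) (by decide)
      (by decide) fun f => by simp only [Fintype.sum_prod_type, Fin.sum_univ_two]; ring)
    (key (0, 1) (0, 0) (1, 0) (1, 1) (by decide) (by decide) (by decide) (by decide) (by decide)
      (by decide) fun f => by simp only [Fintype.sum_prod_type, Fin.sum_univ_two]; ring)
    (key (1, 0) (0, 0) (0, 1) (1, 1) (by decide) (by decide) (by decide) (by decide) (by decide)
      (by decide) fun f => by simp only [Fintype.sum_prod_type, Fin.sum_univ_two]; ring)
    (key (1, 1) (0, 0) (0, 1) (1, 0) (by decide) (by decide) (by decide) (by decide) (by decide)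
      (by decide) fun f => by simp only [Fintype.sum_prod_type, Fin.sum_univ_two]; ring)
  refine ⟨W * Q, ?_, fun k => ?_⟩
  · rw [conjTranspose_mul, Matrix.mul_assoc, ← Matrix.mul_assoc Q, hQ, Matrix.one_mul]
  · have h1 : (W * Q)ᵀ * (ε ⊗ₖ ε) * (W * Q) = Qᵀ * (Wᵀ * (ε ⊗ₖ ε) * W) * Q := by
      rw [transpose_mul]; simp only [Matrix.mul_assoc]
    have h2 := hdet (W * Q) k
    rw [h1, hW, hQ'] at h2
    simpa using h2.symm

open Filter Topology in
theorem HasProductColumns.of_tendsto {ρ : Matrix (Fin 2 × Fin 2) (Fin 2 × Fin 2) ℂ}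
    {σ : ℕ → Matrix (Fin 2 × Fin 2) (Fin 2 × Fin 2) ℂ} (hσ : ∀ n, HasProductColumns (σ n))
    (hlim : Tendsto σ atTop (𝓝 ρ)) {C : ℝ} (hC : ∀ n i, (σ n i i).re ≤ C) :
    HasProductColumns ρ := by
  choose W hW hdet using hσ
  let K : Set (Matrix (Fin 2 × Fin 2) (Fin 2 × Fin 2) ℂ) :=
    Set.pi Set.univ fun _ => Set.pi Set.univ fun _ => Metric.closedBall 0 √C
  have hK : IsCompact K :=
    isCompact_univ_pi fun _ => isCompact_univ_pi fun _ => isCompact_closedBall _ _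
  have hWK : ∀ n, W n ∈ K := fun n i _ j _ => by
    rw [mem_closedBall_zero_iff]
    refine Real.le_sqrt_of_sq_le ?_
    refine le_trans ?_ (hC n i)
    rw [← hW n, mul_apply, Complex.re_sum]
    have : ∀ k, (W n i k * (W n)ᴴ k i).re = ‖W n i k‖ ^ 2 := fun k => by
      rw [conjTranspose_apply, RCLike.star_def, Complex.mul_conj']
      exact_mod_cast Complex.ofReal_re _
    simp only [this]
    exact Finset.single_le_sum (f := fun k => ‖W n i k‖ ^ 2) (fun k _ => by positivity)
      (Finset.mem_univ j)
  have : FirstCountableTopology (Matrix (Fin 2 × Fin 2) (Fin 2 × Fin 2) ℂ) :=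
    inferInstanceAs (FirstCountableTopology (Fin 2 × Fin 2 → Fin 2 × Fin 2 → ℂ))
  obtain ⟨V, -, φ, hφ, hV⟩ := hK.tendsto_subseq hWK
  refine ⟨V, ?_, fun k => ?_⟩
  · have hc : Continuous fun W : Matrix (Fin 2 × Fin 2) (Fin 2 × Fin 2) ℂ => W * Wᴴ := by fun_prop
    refine tendsto_nhds_unique ((hc.tendsto V).comp hV) ?_
    have := hlim.comp hφ.tendsto_atTop
    refine this.congr fun n => ?_
    exact (hW _).symm
  · have hc : Continuous fun W : Matrix (Fin 2 × Fin 2) (Fin 2 × Fin 2) ℂ =>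
        (columnMatrix W k).det := by
      simp only [det_fin_two, columnMatrix, of_apply]
      fun_prop
    refine tendsto_nhds_unique ((hc.tendsto V).comp hV) ?_
    refine tendsto_const_nhds.congr fun n => ?_
    exact (hdet _ _).symm

open Filter Topology in
theorem hasProductColumns_of_posSemidef {ρ : Matrix (Fin 2 × Fin 2) (Fin 2 × Fin 2) ℂ}
    (hρ : ρ.PosSemidef) (hpt : (ptransposeB ρ).PosSemidef) : HasProductColumns ρ := by
  have hpos : ∀ n : ℕ, (0 : ℂ) < ((1 / ((n : ℝ) + 1) : ℝ) : ℂ) := fun n => by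
    exact_mod_cast Nat.one_div_pos_of_nat
  refine HasProductColumns.of_tendsto
    (σ := fun n => ρ + ((1 / ((n : ℝ) + 1) : ℝ) : ℂ) • 1) (C := ∑ i, (ρ i i).re + 1)
    (fun n => hasProductColumns_of_posDef ?_ ?_) ?_ fun n i => ?_
  · exact PosDef.posSemidef_add hρ (PosDef.one.smul (hpos n))
  · have : ptransposeB (ρ + ((1 / ((n : ℝ) + 1) : ℝ) : ℂ) • 1) =
        ptransposeB ρ + ((1 / ((n : ℝ) + 1) : ℝ) : ℂ) • 1 := by
      ext ⟨i, j⟩ ⟨k, l⟩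
      simp only [ptransposeB, of_apply, Matrix.add_apply, Matrix.smul_apply, one_apply, Prod.mk.injEq,
        eq_comm (a := l)]
    rw [this]
    exact hpt.add (PosSemidef.one.smul (hpos n).le)
  · have h := (Complex.continuous_ofReal.tendsto 0).comp
      (tendsto_one_div_add_atTop_nhds_zero_nat (𝕜 := ℝ))
    have h2 := (h.smul_const (1 : Matrix (Fin 2 × Fin 2) (Fin 2 × Fin 2) ℂ)).const_add ρ
    simpa using h2
  · have h1 : (ρ i i).re ≤ ∑ i, (ρ i i).re :=
      Finset.single_le_sum (f := fun i => (ρ i i).re)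
        (fun i _ => (Complex.nonneg_iff.1 hρ.diag_nonneg).1) (Finset.mem_univ i)
    have h2 : 1 / ((n : ℝ) + 1) ≤ 1 := by
      rw [div_le_one (by positivity)]; linarith [n.cast_nonneg (α := ℝ)]
    rw [Matrix.add_apply, Matrix.smul_apply, one_apply_eq, smul_eq_mul, mul_one, Complex.add_re,
      Complex.ofReal_re]
    exact add_le_add h1 h2

theorem exists_eq_mul_of_det_eq_zero {M : Matrix (Fin 2) (Fin 2) ℂ} (hM : M.det = 0) :
    ∃ x y : Fin 2 → ℂ, y ≠ 0 ∧ ∀ i j, M i j = x i * y j := by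
  obtain ⟨v, hv, h⟩ := exists_mulVec_eq_zero_iff.2 hM
  have h' : ∀ i, M i 0 * v 0 + M i 1 * v 1 = 0 := fun i => by
    simpa [mulVec, dotProduct, Fin.sum_univ_two] using congrFun h i
  by_cases h0 : v 0 = 0
  · have h1 : v 1 ≠ 0 := fun h1 => hv (by ext i; fin_cases i <;> assumption)
    refine ⟨fun i => M i 0, ![1, 0], fun h => by simpa using congrFun h 0, fun i j => ?_⟩
    have := h' i
    simp only [h0, mul_zero, zero_add, mul_eq_zero, h1, or_false] at this
    fin_cases j <;> simp [this]
  · refine ⟨fun i => M i 1 / v 0, ![-v 1, v 0],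
      fun h => h0 (by simpa using congrFun h 1), fun i j => ?_⟩
    fin_cases j
    · simp only [Fin.zero_eta, cons_val_zero]
      field_simp
      linear_combination h' i
    · simp [h0]

theorem posSemidef_and_trace_of_ne_zero {n : Type*} [Fintype n] {x : n → ℂ} (hx : x ≠ 0) :
    ∃ (c : ℝ) (A : Matrix n n ℂ), 0 ≤ c ∧ A.PosSemidef ∧ A.trace = 1 ∧
      vecMulVec x (star x) = (c : ℂ) • A := by
  have hpos : 0 < x ⬝ᵥ star x := dotProduct_self_star_pos_iff.2 hx
  have hc : (((x ⬝ᵥ star x).re : ℝ) : ℂ) = x ⬝ᵥ star x :=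
    Complex.ext rfl (Complex.pos_iff.1 hpos).2
  refine ⟨(x ⬝ᵥ star x).re, (x ⬝ᵥ star x)⁻¹ • vecMulVec x (star x),
    (Complex.pos_iff.1 hpos).1.le,
    (posSemidef_vecMulVec_self_star x).smul (inv_nonneg.2 hpos.le), ?_, ?_⟩
  · rw [trace_smul, trace_vecMulVec, smul_eq_mul, inv_mul_cancel₀ hpos.ne']
  · rw [hc, smul_smul, mul_inv_cancel₀ hpos.ne', one_smul]

theorem HasProductColumns.separable {ρ : Matrix (Fin 2 × Fin 2) (Fin 2 × Fin 2) ℂ}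
    (h : HasProductColumns ρ) (htr : ρ.trace = 1) : Separable ρ := by
  obtain ⟨W, rfl, hW⟩ := h
  have key : ∀ k, ∃ (p : ℝ) (A B : Matrix (Fin 2) (Fin 2) ℂ), 0 ≤ p ∧
      (A.PosSemidef ∧ A.trace = 1) ∧ (B.PosSemidef ∧ B.trace = 1) ∧
      (of fun a b => W a k * star (W b k)) = (p : ℂ) • (A ⊗ₖ B) := fun k => by
    obtain ⟨x, y, hy, hxy⟩ := exists_eq_mul_of_det_eq_zero (hW k)
    obtain ⟨d, B, hd, hB, hB', hyB⟩ := posSemidef_and_trace_of_ne_zero hy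
    have hWk : ∀ a : Fin 2 × Fin 2, W a k = x a.1 * y a.2 := fun a => hxy a.1 a.2
    by_cases hx : x = 0
    · refine ⟨0, B, B, le_rfl, ⟨hB, hB'⟩, ⟨hB, hB'⟩, ?_⟩
      ext a b
      simp [hWk, hx]
    · obtain ⟨c, A, hc, hA, hA', hxA⟩ := posSemidef_and_trace_of_ne_zero hx
      refine ⟨c * d, A, B, mul_nonneg hc hd, ⟨hA, hA'⟩, ⟨hB, hB'⟩, ?_⟩
      ext a b
      have e1 := congrFun (congrFun hxA a.1) b.1
      have e2 := congrFun (congrFun hyB a.2) b.2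
      simp only [vecMulVec_apply, Matrix.smul_apply, smul_eq_mul, Pi.star_apply] at e1 e2
      simp only [of_apply, hWk, star_mul', Matrix.smul_apply, kroneckerMap_apply, smul_eq_mul]
      push_cast
      linear_combination y a.2 * star (y b.2) * e1 + c * A a.1 b.1 * e2
  choose p A B hp hA hB hpAB using key
  have hsum : W * Wᴴ = ∑ k, (p k : ℂ) • (A k ⊗ₖ B k) := by
    simp only [← hpAB]
    ext a b
    simp [mul_apply, Matrix.sum_apply]
  refine ⟨2 * 2, p ∘ finProdFinEquiv.symm, A ∘ finProdFinEquiv.symm, B ∘ finProdFinEquiv.symm,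
    fun k => hp _, ?_, fun k => hA _, fun k => hB _, ?_⟩
  · rw [hsum, trace_sum] at htr
    simp only [trace_smul, trace_kronecker, (hA _).2, (hB _).2, mul_one, smul_eq_mul] at htr
    have : ∑ k, p k = 1 := by exact_mod_cast htr
    rw [← this]
    exact finProdFinEquiv.symm.sum_comp p
  · rw [hsum]
    exact (finProdFinEquiv.symm.sum_comp fun k => (p k : ℂ) • (A k ⊗ₖ B k)).symm

theorem Separable.posSemidef_ptransposeB {N M : ℕ}
    {ρ : Matrix (Fin N × Fin M) (Fin N × Fin M) ℂ} (h : Separable ρ) :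
    (ptransposeB ρ).PosSemidef := by
  obtain ⟨L, p, A, B, hp, -, hA, hB, rfl⟩ := h
  have : ptransposeB (∑ k, (p k : ℂ) • (A k ⊗ₖ B k)) = ∑ k, (p k : ℂ) • (A k ⊗ₖ (B k)ᵀ) := by
    ext a b
    simp [ptransposeB, Matrix.sum_apply]
  rw [this]
  exact posSemidef_sum _ fun k _ => ((hA k).1.kronecker (hB k).1.transpose).smul
    (by exact_mod_cast hp k)

/-- Peres–Horodecki: a two-qubit density matrix is separable if and only if its
partial transpose is positive semidefinite. -/
theorem two_qubit_separable_iff_ppt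
    (ρ : Matrix (Fin 2 × Fin 2) (Fin 2 × Fin 2) ℂ)
    (hρ : ρ.PosSemidef) (htr : ρ.trace = 1) :
    Separable ρ ↔ (ptransposeB ρ).PosSemidef := by
  exact ⟨Separable.posSemidef_ptransposeB, fun h =>
    (hasProductColumns_of_posSemidef hρ h).separable htr⟩
end

section
/- For 0 < p ≤ 1 and either choice of sign, the two-qubit state ρ_± = p·|ψ^±⟩⟨ψ^±| + (1−p)·|00⟩⟨00|, where |ψ^±⟩ = (|01⟩ ± |10⟩)/√2, is not separable. Explicitly, ρ_± is the matrix indexed by (Fin 2 × Fin 2) with entries ρ_{(0,0),(0,0)} = 1−p, ρ_{(0,1),(0,1)} = ρ_{(1,0),(1,0)} = p/2, ρ_{(0,1),(1,0)} = ρ_{(1,0),(0,1)} = ±p/2, and all other entries 0; thus ρ_± is separable only when p = 0. -/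
open Matrix Kronecker
open scoped ComplexOrder

namespace Matrix.PosSemidef

/-- If a diagonal entry of a positive semidefinite matrix vanishes, so does its column. -/
theorem apply_eq_zero_of_diag_eq_zero {n : Type*} [Fintype n] [DecidableEq n]
    {A : Matrix n n ℂ} (hA : A.PosSemidef) {i : n} (h : A i i = 0) (j : n) : A j i = 0 := by
  have hv : A *ᵥ Pi.single i 1 = 0 := by
    rw [← hA.dotProduct_mulVec_zero_iff]
    simp [h]
  simpa using congrFun hv j

/-- If a diagonal entry of a positive semidefinite matrix vanishes, so does its row. -/
theorem apply_eq_zero_of_diag_eq_zero' {n : Type*} [Fintype n] [DecidableEq n]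
    {A : Matrix n n ℂ} (hA : A.PosSemidef) {i : n} (h : A i i = 0) (j : n) : A i j = 0 := by
  rw [← hA.isHermitian.apply, hA.apply_eq_zero_of_diag_eq_zero h, star_zero]

end Matrix.PosSemidef

/-- If the diagonal entry of a separable matrix at `(i, j)` vanishes, then so does every entry
at `((k, j), (i, l))`. -/
theorem Separable.apply_eq_zero_of_diag_eq_zero {N M : ℕ}
    {ρ : Matrix (Fin N × Fin M) (Fin N × Fin M) ℂ} (hρ : Separable ρ) {i : Fin N} {j : Fin M}
    (h : ρ (i, j) (i, j) = 0) (k : Fin N) (l : Fin M) : ρ (k, j) (i, l) = 0 := by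
  obtain ⟨L, p, A, B, hp, -, hA, hB, rfl⟩ := hρ
  simp only [Matrix.sum_apply, Matrix.smul_apply, kroneckerMap_apply, smul_eq_mul] at h ⊢
  have hterm_nonneg : ∀ m ∈ Finset.univ, 0 ≤ (p m : ℂ) * (A m i i * B m j j) := fun m _ =>
    mul_nonneg (Complex.zero_le_real.mpr (hp m))
      (mul_nonneg (hA m).1.diag_nonneg (hB m).1.diag_nonneg)
  rw [Finset.sum_eq_zero_iff_of_nonneg hterm_nonneg] at h
  refine Finset.sum_eq_zero fun m hm => ?_
  rcases mul_eq_zero.mp (h m hm) with hpm | hAB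
  · rw [hpm, zero_mul]
  rcases mul_eq_zero.mp hAB with hAm | hBm
  · rw [(hA m).1.apply_eq_zero_of_diag_eq_zero hAm, zero_mul, mul_zero]
  · rw [(hB m).1.apply_eq_zero_of_diag_eq_zero' hBm, mul_zero, mul_zero]

/-- For `0 < p ≤ 1` and either sign `ε = ±1`, the two-qubit state
`ρ_± = p·|ψ^±⟩⟨ψ^±| + (1−p)·|00⟩⟨00|`, `|ψ^±⟩ = (|01⟩ ± |10⟩)/√2`, is not separable
(so it is separable only when `p = 0`). -/
theorem p_zero_state_not_separable
    (p : ℝ) (hp0 : 0 < p) (hp1 : p ≤ 1) (ε : ℝ) (hε : ε = 1 ∨ ε = -1) :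
    ¬ Separable (Matrix.of fun x y : Fin 2 × Fin 2 =>
      if x = (0, 0) ∧ y = (0, 0) then ((1 - p : ℝ) : ℂ)
      else if x = (0, 1) ∧ y = (0, 1) then ((p / 2 : ℝ) : ℂ)
      else if x = (1, 0) ∧ y = (1, 0) then ((p / 2 : ℝ) : ℂ)
      else if x = (0, 1) ∧ y = (1, 0) then ((ε * p / 2 : ℝ) : ℂ)
      else if x = (1, 0) ∧ y = (0, 1) then ((ε * p / 2 : ℝ) : ℂ)
      else 0) := by
  intro h
  have h0 := h.apply_eq_zero_of_diag_eq_zero (i := 1) (j := 1) (by simp) 0 0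
  have hε0 : ε ≠ 0 := by rcases hε with rfl | rfl <;> norm_num
  simp [hε0, hp0.ne'] at h0
end
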